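/- For each s ∈ ℕ*, there exists no x ∈ ℤ^3 ∖ 2^{s+1}ℤ^3 such that Σ_{s,x}(𝒞^s) ≺ x + Σ_{s,0}(𝒞^s). -/

import Mathlib

namespace Folding

noncomputable section

open Set

/-- Points of `ℝ^n` with the euclidean distance. -/
abbrev Pt (n : ℕ) := EuclideanSpace ℝ (Fin n)

/-- `p` is a point of the lattice `ℤ^n`. -/
def latt {n : ℕ} (p : Pt n) : Prop := ∀ i, ∃ m : ℤ, p i = (m : ℝ)

/-- `p` belongs to `m·ℤ^n`. -/
def inLat {n : ℕ} (m : ℕ) (p : Pt n) : Prop := ∀ i, ∃ c : ℤ, p i = (m : ℝ) * (c : ℝ)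

/-- The canonical basis vector `e_i`. -/
def uvec (n : ℕ) (i : Fin n) : Pt n := EuclideanSpace.single i (1 : ℝ)

/-- `u` belongs to `E = {e_1, -e_1, …, e_n, -e_n}`. -/
def IsDir {n : ℕ} (u : Pt n) : Prop := ∃ i, u = uvec n i ∨ u = -uvec n i

/-- A (nonoriented) lattice segment `[x, x + e_i]`, as an unordered pair of endpoints. -/
def IsSeg {n : ℕ} (S : Sym2 (Pt n)) : Prop := ∃ x i, latt x ∧ S = s(x, x + uvec n i)

/-- A curve: a sequence of segments, indexed by an interval of `ℤ` (finite, ℕ-like or ℤ-like),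
recorded through its sequence of vertices; two consecutive segments have exactly one common
endpoint, and the common endpoints with the preceding and the following segments differ
(`noback`). -/
structure Curve (n : ℕ) where
  dom : Set ℤ
  ordConn : dom.OrdConnected
  nontriv : ∃ i, i ∈ dom ∧ i + 1 ∈ dom
  v : ℤ → Pt n
  lattice : ∀ i ∈ dom, latt (v i)
  step : ∀ i : ℤ, i ∈ dom → i + 1 ∈ dom →
    ∃ j, v (i + 1) = v i + uvec n j ∨ v (i + 1) = v i - uvec n j
  noback : ∀ i : ℤ, i - 1 ∈ dom → i + 1 ∈ dom → v (i + 1) ≠ v (i - 1)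

namespace Curve

variable {n : ℕ} (c : Curve n)

/-- The segments of a curve. -/
def segs : Set (Sym2 (Pt n)) :=
  {S | ∃ i : ℤ, i ∈ c.dom ∧ i + 1 ∈ c.dom ∧ S = s(c.v i, c.v (i + 1))}

/-- The connexions between segments of a curve: pairs of consecutive segments. -/
def conn (S T : Sym2 (Pt n)) : Prop :=
  ∃ i : ℤ, i - 1 ∈ c.dom ∧ i + 1 ∈ c.dom ∧
    ((S = s(c.v (i - 1), c.v i) ∧ T = s(c.v i, c.v (i + 1))) ∨
     (T = s(c.v (i - 1), c.v i) ∧ S = s(c.v i, c.v (i + 1))))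

/-- A curve is self-avoiding if each of its segments appears only once. -/
def SelfAvoiding : Prop :=
  ∀ i j : ℤ, i ∈ c.dom → i + 1 ∈ c.dom → j ∈ c.dom → j + 1 ∈ c.dom →
    s(c.v i, c.v (i + 1)) = s(c.v j, c.v (j + 1)) → i = j

/-- A curve without endpoints (indexed by `ℤ`). -/
def NoEndpts : Prop := c.dom = Set.univ

/-- `p` is an endpoint of the curve `c`. -/
def IsEndpt (p : Pt n) : Prop :=
  ∃ i ∈ c.dom, p = c.v i ∧ (i - 1 ∉ c.dom ∨ i + 1 ∉ c.dom)

/-- `S` is the end segment of `c` at its endpoint `p`. -/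
def endSegAt (p : Pt n) (S : Sym2 (Pt n)) : Prop :=
  ∃ i : ℤ, i ∈ c.dom ∧ p = c.v i ∧
    ((i - 1 ∉ c.dom ∧ i + 1 ∈ c.dom ∧ S = s(c.v i, c.v (i + 1))) ∨
     (i + 1 ∉ c.dom ∧ i - 1 ∈ c.dom ∧ S = s(c.v (i - 1), c.v i)))

/-- The number of segments (length) of a curve. -/
def nsegs : ℕ := {i : ℤ | i ∈ c.dom ∧ i + 1 ∈ c.dom}.ncard

end Curve

/-- The trace of a set of curves: its set of segments together with the connexion
relation between segments.  Two sets of curves are geometrically the same set of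
(nonoriented) curves iff they have the same trace. -/
structure Trace (n : ℕ) where
  segs : Set (Sym2 (Pt n))
  conn : Sym2 (Pt n) → Sym2 (Pt n) → Prop

def curveTrace {n : ℕ} (c : Curve n) : Trace n := ⟨c.segs, c.conn⟩

def traceOf {n : ℕ} (E : Set (Curve n)) : Trace n :=
  ⟨{S | ∃ c ∈ E, S ∈ c.segs}, fun S T => ∃ c ∈ E, c.conn S T⟩

/-- Two curves are the same nonoriented curve. -/
def SameCurve {n : ℕ} (c d : Curve n) : Prop := c.segs = d.segs ∧ c.conn = d.conn

/-- A set of pairwise disjoint self-avoiding curves. -/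
def DisjSA {n : ℕ} (E : Set (Curve n)) : Prop :=
  (∀ c ∈ E, c.SelfAvoiding) ∧
  ∀ c ∈ E, ∀ d ∈ E, ¬ SameCurve c d → ∀ S, S ∈ c.segs → S ∉ d.segs

/-- The set of points of `ℝ^n` lying on the segment `S`. -/
def segPts {n : ℕ} (S : Sym2 (Pt n)) : Set (Pt n) :=
  {p | ∃ a b, S = s(a, b) ∧ ∃ t : ℝ, 0 ≤ t ∧ t ≤ 1 ∧ p = a + t • (b - a)}

def Trace.pts {n : ℕ} (T : Trace n) : Set (Pt n) := ⋃ S ∈ T.segs, segPts S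

/-- A set of curves covers `X ⊆ ℝ^n`: each lattice segment containing a point of `X`
appears in one and only one of the curves. -/
def Covers {n : ℕ} (E : Set (Curve n)) (X : Set (Pt n)) : Prop :=
  ∀ S, IsSeg S → (segPts S ∩ X).Nonempty →
    (∃ c ∈ E, S ∈ c.segs) ∧ ∀ c ∈ E, ∀ d ∈ E, S ∈ c.segs → S ∈ d.segs → SameCurve c d

/-- A covering of `ℝ^n` by disjoint self-avoiding curves. -/
def IsCovering {n : ℕ} (E : Set (Curve n)) : Prop := DisjSA E ∧ Covers E Set.univ

/-- A single curve covers `X`. -/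
def CurveCovers {n : ℕ} (c : Curve n) (X : Set (Pt n)) : Prop :=
  ∀ S, IsSeg S → (segPts S ∩ X).Nonempty → S ∈ c.segs

/-- `b` is a curve contained in the curve `a`. -/
def SubCurve {n : ℕ} (b a : Curve n) : Prop :=
  b.segs ⊆ a.segs ∧ ∀ S T, b.conn S T → a.conn S T

/-- The relation `≺` at the level of traces. -/
def TPrec {n : ℕ} (T T' : Trace n) : Prop :=
  T.segs ⊆ T'.segs ∧ ∀ S S', T.conn S S' → T'.conn S S'

/-- `E ≺ F` : each segment of a curve of `E` is a segment of a curve of `F` and each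
connexion between two segments of a curve of `E` also exists in `F`. -/
def Prec {n : ℕ} (E F : Set (Curve n)) : Prop := TPrec (traceOf E) (traceOf F)

/-- Image of a trace under a map of `ℝ^n`. -/
def Trace.map {n : ℕ} (f : Pt n → Pt n) (T : Trace n) : Trace n :=
  ⟨Sym2.map f '' T.segs,
   fun S S' => ∃ A B, T.conn A B ∧ S = Sym2.map f A ∧ S' = Sym2.map f B⟩

/-- Translation of a trace by the vector `t`. -/
def Trace.transl {n : ℕ} (t : Pt n) (T : Trace n) : Trace n := T.map (fun p => p + t)

/-- Property (H) for the pair `(k, l)`. -/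
def SatH {n : ℕ} (A : Set (Curve n)) (k l : ℕ) : Prop :=
  0 < k ∧ 0 < l ∧ k ∣ l ∧ IsCovering A ∧
  (∀ c ∈ A, c.dom.Finite ∧ ∃ x i, latt x ∧ inLat k x ∧ c.IsEndpt x ∧
      c.IsEndpt (x + (k : ℝ) • uvec n i) ∧
      ∀ p, c.IsEndpt p → p = x ∨ p = x + (k : ℝ) • uvec n i) ∧
  (∀ (x : Pt n) (i : Fin n), latt x → inLat k x →
      (∃ c ∈ A, c.IsEndpt x ∧ c.IsEndpt (x + (k : ℝ) • uvec n i)) ∧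
      ∀ c ∈ A, ∀ d ∈ A, c.IsEndpt x → c.IsEndpt (x + (k : ℝ) • uvec n i) →
        d.IsEndpt x → d.IsEndpt (x + (k : ℝ) • uvec n i) → SameCurve c d) ∧
  (∀ t : Pt n, inLat l t → Trace.transl t (traceOf A) = traceOf A)

/-- The trace of the convolution product `A ∗ B`, where `A` satisfies (H) for `(k, l)`:
apply to `B` the homothety of center `0` and ratio `k`, then replace each resulting
segment by the curve of `A` having the same endpoints (connexions come from the curves
of `A`, together with the junctions of the end segments of consecutive `A`-curves). -/
def ConvTrace {n : ℕ} (k : ℕ) (A B : Set (Curve n)) : Trace n where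
  segs := {S | ∃ a b : Pt n, s(a, b) ∈ (traceOf B).segs ∧
    ∃ c ∈ A, c.IsEndpt ((k : ℝ) • a) ∧ c.IsEndpt ((k : ℝ) • b) ∧ S ∈ c.segs}
  conn := fun S S' =>
    (∃ a b : Pt n, s(a, b) ∈ (traceOf B).segs ∧
      ∃ c ∈ A, c.IsEndpt ((k : ℝ) • a) ∧ c.IsEndpt ((k : ℝ) • b) ∧ c.conn S S') ∨
    (∃ a b d : Pt n, (traceOf B).conn s(a, b) s(b, d) ∧
      ∃ c ∈ A, ∃ c' ∈ A, c.IsEndpt ((k : ℝ) • a) ∧ c.IsEndpt ((k : ℝ) • b) ∧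
        c'.IsEndpt ((k : ℝ) • b) ∧ c'.IsEndpt ((k : ℝ) • d) ∧
        ((c.endSegAt ((k : ℝ) • b) S ∧ c'.endSegAt ((k : ℝ) • b) S') ∨
         (c.endSegAt ((k : ℝ) • b) S' ∧ c'.endSegAt ((k : ℝ) • b) S)))

/-- The two-sided identity of the convolution product: the covering consisting of all
curves with one segment. -/
def unitTrace (n : ℕ) : Trace n := ⟨{S | IsSeg S}, fun _ _ => False⟩

/-- `P s` realizes the power `A^s` for the convolution product. -/
def PowersOf {n : ℕ} (A : Set (Curve n)) (k : ℕ) (P : ℕ → Set (Curve n)) : Prop :=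
  (∀ s, DisjSA (P s)) ∧ traceOf (P 0) = unitTrace n ∧
  ∀ s, traceOf (P (s + 1)) = ConvTrace k A (P s)

/-- The trace of `Â`, the inductive limit of the `A^s` for `≺`. -/
def hatTrace {n : ℕ} (P : ℕ → Set (Curve n)) : Trace n :=
  ⟨{S | ∃ s, S ∈ (traceOf (P s)).segs}, fun S T => ∃ s, (traceOf (P s)).conn S T⟩

/-- A pairing relation on `E = {e_1, -e_1, …, e_n, -e_n}`. -/
def IsPairing {n : ℕ} (R : Pt n → Pt n → Prop) : Prop :=
  (∀ u v, R u v → R v u) ∧ (∀ u v, R u v → IsDir u ∧ IsDir v) ∧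
  (∀ u, ¬ R u u) ∧ ∀ u, IsDir u → ∃! v, R u v

/-- The trace of `Â_R` : `Â` with the segments with endpoint `0` connected according
to `R`. -/
def hatRTrace {n : ℕ} (P : ℕ → Set (Curve n)) (R : Pt n → Pt n → Prop) : Trace n :=
  ⟨(hatTrace P).segs,
   fun S T => (hatTrace P).conn S T ∨
     ∃ u v, R u v ∧ S = s((0 : Pt n), u) ∧ T = s((0 : Pt n), v)⟩

/-- The cube `P_{x,h}`. -/
def cube {n : ℕ} (x : Pt n) (h : ℕ) : Set (Pt n) :=
  {p | ∀ i, x i - h ≤ p i ∧ p i ≤ x i + h}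

/-- Restriction of a trace to a region `X` of `ℝ^n`. -/
def Trace.restr {n : ℕ} (T : Trace n) (X : Set (Pt n)) : Trace n :=
  ⟨{S | S ∈ T.segs ∧ segPts S ⊆ X},
   fun S S' => T.conn S S' ∧ segPts S ⊆ X ∧ segPts S' ⊆ X⟩

/-- Condition (C). -/
def CondC {n : ℕ} (T : Trace n) : Prop :=
  ∀ (x : Pt n) (h : ℕ), latt x → 1 ≤ h →
    ∃ y : Pt n, latt y ∧ y ∉ cube x h ∧
      Trace.transl (y - x) (T.restr (cube x h)) = T.restr (cube y h)

/-- `(B(x,r) ∩ T, x) ≅ (B(y,r) ∩ T', y)` : the translation sending `x` to `y` maps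
the part of `T` in the closed ball `B(x,r)` onto the part of `T'` in `B(y,r)`,
preserving the connexions between segments. -/
def BallIso {n : ℕ} (T : Trace n) (x : Pt n) (T' : Trace n) (y : Pt n) (r : ℝ) : Prop :=
  (fun p => p + (y - x)) '' (T.pts ∩ Metric.closedBall x r) =
      T'.pts ∩ Metric.closedBall y r ∧
  (∀ S S', T.conn S S' → segPts S ⊆ Metric.closedBall x r →
      segPts S' ⊆ Metric.closedBall x r →
      T'.conn (Sym2.map (fun p => p + (y - x)) S) (Sym2.map (fun p => p + (y - x)) S')) ∧
  (∀ S S', T'.conn S S' → segPts S ⊆ Metric.closedBall y r →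
      segPts S' ⊆ Metric.closedBall y r →
      T.conn (Sym2.map (fun p => p + (x - y)) S) (Sym2.map (fun p => p + (x - y)) S'))

/-- The local isomorphism property. -/
def LocIsoProp {n : ℕ} (T : Trace n) : Prop :=
  ∀ (x : Pt n) (r : ℝ), 0 ≤ r →
    ∃ t : ℝ, 0 ≤ t ∧ ∀ y : Pt n, ∃ z ∈ Metric.closedBall y t, BallIso T x T z r

/-- Two traces are locally isomorphic. -/
def LocallyIso {n : ℕ} (T T' : Trace n) : Prop :=
  (∀ (x : Pt n) (r : ℝ), 0 ≤ r → ∃ y, BallIso T x T' y r) ∧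
  (∀ (y : Pt n) (r : ℝ), 0 ≤ r → ∃ x, BallIso T' y T x r)

/-- `Ω_{s,x}` : suppress the connexions between segments whose common endpoint lies in
`x + k^s ℤ^n`. -/
def OmegaTrace {n : ℕ} (k s : ℕ) (x : Pt n) (T : Trace n) : Trace n :=
  ⟨T.segs, fun S S' => T.conn S S' ∧ ¬ ∃ p, p ∈ S ∧ p ∈ S' ∧ inLat (k ^ s) (p - x)⟩

/-- `Σ_{s,x}(E)` : for each curve `D` of `E` passing through `x`, the curve(s) with
endpoint `x` contained in `D` having maximal length, this length being limited to
`8^s`. -/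
def SigmaSet {n : ℕ} (s : ℕ) (x : Pt n) (E : Set (Curve n)) : Set (Curve n) :=
  {b | ∃ D ∈ E, SubCurve b D ∧ b.IsEndpt x ∧ b.nsegs ≤ 8 ^ s ∧
    ∀ b' : Curve n, SubCurve b' D → b'.IsEndpt x → b'.nsegs ≤ 8 ^ s →
      SubCurve b b' → SameCurve b b'}

/-- A positive (orientation preserving) isometry of `ℝ^n`. -/
def PosIsom {n : ℕ} (f : Pt n → Pt n) : Prop :=
  ∃ (g : Pt n ≃ₗᵢ[ℝ] Pt n) (t : Pt n), (∀ x, f x = g x + t) ∧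
    0 < LinearMap.det (g.toLinearEquiv.toLinearMap)

/-- `E` consists of exactly `m` curves. -/
def HasExactly {n : ℕ} (E : Set (Curve n)) (m : ℕ) : Prop :=
  ∃ L : List (Curve n), L.length = m ∧ (∀ c ∈ L, c ∈ E) ∧
    L.Pairwise (fun c d => ¬ SameCurve c d) ∧ ∀ c ∈ E, ∃ d ∈ L, SameCurve c d

/-- `E` consists of at most `m` curves. -/
def AtMost {n : ℕ} (E : Set (Curve n)) (m : ℕ) : Prop :=
  ∃ L : List (Curve n), L.length ≤ m ∧ ∀ c ∈ E, ∃ d ∈ L, SameCurve c d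

/-- The set of points of a curve. -/
def curvePts {n : ℕ} (c : Curve n) : Set (Pt n) := ⋃ S ∈ c.segs, segPts S

-- ℝ³-specific part
def toPt3 (f : Fin 3 → ℝ) : Pt 3 := (WithLp.equiv 2 (Fin 3 → ℝ)).symm f

def p3 (a b c : ℤ) : Pt 3 := toPt3 ![(a : ℝ), (b : ℝ), (c : ℝ)]

/-- The vertices of the curve `C`. -/
def CList : List (Pt 3) :=
  [p3 0 0 0, p3 0 (-1) 0, p3 0 (-1) (-1), p3 0 0 (-1), p3 1 0 (-1),
   p3 1 (-1) (-1), p3 1 (-1) 0, p3 1 0 0, p3 2 0 0]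

/-- The block `ℬ₀` : six curves given by their lists of successive vertices. -/
def B0 : List (List (Pt 3)) :=
  [ CList,
    [p3 0 0 0, p3 0 0 1, p3 0 1 1, p3 0 1 0, p3 (-1) 1 0, p3 (-1) 1 1,
     p3 (-1) 0 1, p3 (-1) 0 0, p3 (-2) 0 0],
    [p3 0 0 0, p3 0 0 (-1), p3 (-1) 0 (-1), p3 (-1) 0 0, p3 (-1) 1 0,
     p3 (-1) 1 (-1), p3 0 1 (-1), p3 0 1 0, p3 0 2 0],
    [p3 0 0 0, p3 1 0 0, p3 1 0 1, p3 0 0 1, p3 0 (-1) 1, p3 1 (-1) 1,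
     p3 1 (-1) 0, p3 0 (-1) 0, p3 0 (-2) 0],
    [p3 0 0 0, p3 (-1) 0 0, p3 (-1) (-1) 0, p3 0 (-1) 0, p3 0 (-1) 1,
     p3 (-1) (-1) 1, p3 (-1) 0 1, p3 0 0 1, p3 0 0 2],
    [p3 0 0 0, p3 0 1 0, p3 1 1 0, p3 1 0 0, p3 1 0 (-1), p3 1 1 (-1),
     p3 0 1 (-1), p3 0 0 (-1), p3 0 0 (-2)] ]

def sigma3 : Pt 3 → Pt 3 := fun x => toPt3 ![x 0, -(x 1), -(x 2)]
def tau3 : Pt 3 → Pt 3 := fun x => toPt3 ![x 0, x 2, -(x 1)]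
def ups3 : Pt 3 → Pt 3 := fun x => toPt3 ![x 0, -(x 2), x 1]

/-- The four blocks `ℬ₀, ℬ₁, ℬ₂, ℬ₃`. -/
def blockLists : Fin 4 → List (List (Pt 3)) :=
  ![B0,
    B0.map (List.map fun p => p3 2 2 0 + sigma3 p),
    B0.map (List.map fun p => p3 2 0 2 + tau3 p),
    B0.map (List.map fun p => p3 0 2 2 + ups3 p)]

def listSegs (L : List (Pt 3)) : Set (Sym2 (Pt 3)) :=
  {S | ∃ j : ℕ, j + 1 < L.length ∧ S = s(L.getD j 0, L.getD (j + 1) 0)}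

def listConn (L : List (Pt 3)) (S T : Sym2 (Pt 3)) : Prop :=
  ∃ j : ℕ, j + 2 < L.length ∧
    ((S = s(L.getD j 0, L.getD (j + 1) 0) ∧ T = s(L.getD (j + 1) 0, L.getD (j + 2) 0)) ∨
     (T = s(L.getD j 0, L.getD (j + 1) 0) ∧ S = s(L.getD (j + 1) 0, L.getD (j + 2) 0)))

/-- The trace of the curve given by a list of successive vertices. -/
def listTrace (L : List (Pt 3)) : Trace 3 := ⟨listSegs L, listConn L⟩

/-- The trace of the covering `𝒞 = ⋃_{u ∈ ℤ³, 0 ≤ i ≤ 3} (4u + ℬ_i)`. -/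
def CTrace : Trace 3 where
  segs := {S | ∃ u : Pt 3, latt u ∧ ∃ (i : Fin 4), ∃ M ∈ blockLists i,
    S ∈ (Trace.transl ((4 : ℝ) • u) (listTrace M)).segs}
  conn := fun S T => ∃ u : Pt 3, latt u ∧ ∃ (i : Fin 4), ∃ M ∈ blockLists i,
    (Trace.transl ((4 : ℝ) • u) (listTrace M)).conn S T

open Classical in
/-- The permutation `θ` of `E` with `θ(e₁) = -e₂`, `θ(e₂) = -e₃`, `θ(e₃) = -e₁`
and `θ² = Id`. -/
def theta3 : Pt 3 → Pt 3 := fun u =>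
  if u = uvec 3 0 then -uvec 3 1
  else if u = -uvec 3 1 then uvec 3 0
  else if u = uvec 3 1 then -uvec 3 2
  else if u = -uvec 3 2 then uvec 3 1
  else if u = uvec 3 2 then -uvec 3 0
  else if u = -uvec 3 0 then uvec 3 2
  else u

/-- `R^θ`. -/
def Rtheta (R : Pt 3 → Pt 3 → Prop) : Pt 3 → Pt 3 → Prop :=
  fun u v => R (theta3 u) (theta3 v)

def Rx (P : ℕ → Set (Curve 3)) (x : Pt 3) : Pt 3 → Pt 3 → Prop :=
  fun u v => (hatTrace P).conn s(x, x + u) s(x, x + v)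

/-- Condition (P). -/
def SatP (P : ℕ → Set (Curve 3)) (R : Pt 3 → Pt 3 → Prop) : Prop :=
  ∃ x : Pt 3, (∀ i, x i = -2 ∨ x i = 0 ∨ x i = 2 ∨ x i = 4) ∧
    (¬ ∀ i, x i = 0 ∨ x i = 4) ∧ (Rx P x = R ∨ Rx P x = Rtheta R)

/-- The trace of `Ĉ_X`, the inductive limit of the sets `x_s + 𝒞^s`. -/
def hatXTrace (P : ℕ → Set (Curve 3)) (x : ℕ → Pt 3) : Trace 3 :=
  ⟨{S | ∃ s, 1 ≤ s ∧ S ∈ (Trace.transl (x s) (traceOf (P s))).segs},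
   fun S T => ∃ s, 1 ≤ s ∧ (Trace.transl (x s) (traceOf (P s))).conn S T⟩

/-- The curve `c` is equivalent to `C` (image of `C` by a positive isometry). -/
def EquivToC (c : Curve 3) : Prop :=
  ∃ f, PosIsom f ∧ curveTrace c = Trace.map f (listTrace CList)

/-- `x` is an endpoint of type `0` (resp. `1`) of the curve `c`, for `c`
equivalent to `C`. -/
def EndptType (c : Curve 3) (x : Pt 3) (ty : ℕ) : Prop :=
  ∃ f, PosIsom f ∧ curveTrace c = Trace.map f (listTrace CList) ∧
    x = f (if ty = 0 then p3 0 0 0 else p3 2 0 0)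

section Curves

variable {n : ℕ}

theorem Curve.mem_dom_of_le (c : Curve n) {i j k : ℤ} (hi : i ∈ c.dom) (hk : k ∈ c.dom)
    (hij : i ≤ j) (hjk : j ≤ k) : j ∈ c.dom :=
  c.ordConn.out hi hk ⟨hij, hjk⟩

theorem Curve.conn_symm {c : Curve n} {S T : Sym2 (Pt n)} (h : c.conn S T) : c.conn T S := by
  obtain ⟨i, h1, h2, h | h⟩ := h
  · exact ⟨i, h1, h2, Or.inr h⟩
  · exact ⟨i, h1, h2, Or.inl h⟩

theorem Curve.left_mem_segs {c : Curve n} {S T : Sym2 (Pt n)} (h : c.conn S T) :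
    S ∈ c.segs := by
  obtain ⟨i, h1, h2, ⟨h, -⟩ | ⟨-, h⟩⟩ := h
  · exact ⟨i - 1, h1, c.mem_dom_of_le h1 h2 (by omega) (by omega), by simpa using h⟩
  · exact ⟨i, c.mem_dom_of_le h1 h2 (by omega) (by omega), h2, h⟩

theorem Curve.right_mem_segs {c : Curve n} {S T : Sym2 (Pt n)} (h : c.conn S T) :
    T ∈ c.segs :=
  Curve.left_mem_segs (Curve.conn_symm h)

theorem Curve.isSeg_of_mem_segs {c : Curve n} {S : Sym2 (Pt n)} (h : S ∈ c.segs) : IsSeg S := by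
  obtain ⟨i, h1, h2, rfl⟩ := h
  obtain ⟨j, hj | hj⟩ := c.step i h1 h2
  · exact ⟨c.v i, j, c.lattice i h1, by rw [hj]⟩
  · exact ⟨c.v (i + 1), j, c.lattice _ h2, by rw [hj, Sym2.eq_swap]; simp⟩

theorem uvec_ne_zero (i : Fin n) : uvec n i ≠ 0 := by
  intro h
  have := congrArg (fun p : Pt n => p i) h
  simp [uvec] at this

theorem IsSeg.ne {a b : Pt n} (h : IsSeg s(a, b)) : a ≠ b := by
  rintro rfl
  obtain ⟨x, i, -, h⟩ := h
  rw [Sym2.eq_iff] at h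
  have : x = x + uvec n i := by
    rcases h with ⟨h1, h2⟩ | ⟨h1, h2⟩
    · exact h1.symm.trans h2
    · exact h2.symm.trans h1
  exact uvec_ne_zero i (by simpa using this.symm)

theorem Curve.reflTransGen_conn {c : Curve n} {S S' : Sym2 (Pt n)} (hS : S ∈ c.segs)
    (hS' : S' ∈ c.segs) : Relation.ReflTransGen c.conn S S' := by
  have key : ∀ i j : ℤ, i ≤ j → i ∈ c.dom → j + 1 ∈ c.dom →
      Relation.ReflTransGen c.conn s(c.v i, c.v (i + 1)) s(c.v j, c.v (j + 1)) := by
    intro i j hij hi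
    induction j, hij using Int.leInduction with
    | base => exact fun _ => Relation.ReflTransGen.refl
    | succ j hij ih =>
      intro hj
      refine (ih (c.mem_dom_of_le hi hj (by omega) (by omega))).tail ?_
      exact ⟨j + 1, c.mem_dom_of_le hi hj (by omega) (by omega), hj, Or.inl ⟨by simp, rfl⟩⟩
  obtain ⟨i, hi, hi', rfl⟩ := hS
  obtain ⟨j, hj, hj', rfl⟩ := hS'
  rcases le_total i j with h | h
  · exact key i j h hi hj'
  · have : Std.Symm c.conn := ⟨fun _ _ h => Curve.conn_symm h⟩
    exact Relation.ReflTransGen.stdSymm.symm _ _ (key j i h hj hi')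

theorem Curve.conn_cases {c : Curve n} {p q r : Pt n} (h : c.conn s(p, q) s(q, r)) (hpr : p ≠ r) :
    ∃ i : ℤ, i - 1 ∈ c.dom ∧ i ∈ c.dom ∧ i + 1 ∈ c.dom ∧ c.v i = q ∧
      ((c.v (i - 1) = p ∧ c.v (i + 1) = r) ∨ (c.v (i - 1) = r ∧ c.v (i + 1) = p)) := by
  obtain ⟨i, h1, h2, h⟩ := h
  refine ⟨i, h1, c.mem_dom_of_le h1 h2 (by omega) (by omega), h2, ?_⟩
  simp only [Sym2.eq_iff] at h
  grind

theorem sameCurve_of_mem_segs {E : Set (Curve n)} (hE : DisjSA E) {c d : Curve n} (hc : c ∈ E)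
    (hd : d ∈ E) {S : Sym2 (Pt n)} (hSc : S ∈ c.segs) (hSd : S ∈ d.segs) : SameCurve c d := by
  by_contra h
  exact hE.2 c hc d hd h S hSc hSd

theorem conn_of_traceOf_conn {E : Set (Curve n)} (hE : DisjSA E) {D : Curve n} (hD : D ∈ E)
    {S T : Sym2 (Pt n)} (hS : S ∈ D.segs) (h : (traceOf E).conn S T) : D.conn S T := by
  obtain ⟨c, hc, h⟩ := h
  rw [← (sameCurve_of_mem_segs hE hc hD (Curve.left_mem_segs h) hS).2]
  exact h

theorem mem_segs_of_chain {E : Set (Curve n)} (hE : DisjSA E) {D : Curve n} (hD : D ∈ E)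
    {S T : Sym2 (Pt n)} (hS : S ∈ D.segs)
    (h : Relation.ReflTransGen (traceOf E).conn S T) : T ∈ D.segs := by
  induction h with
  | refl => exact hS
  | tail _ h ih => exact Curve.right_mem_segs (conn_of_traceOf_conn hE hD ih h)

theorem traceOf_conn_symm {E : Set (Curve n)} {S T : Sym2 (Pt n)} (h : (traceOf E).conn S T) :
    (traceOf E).conn T S := by
  obtain ⟨c, hc, h⟩ := h
  exact ⟨c, hc, Curve.conn_symm h⟩

theorem traceOf_conn_unique {E : Set (Curve n)} (hE : DisjSA E) {p q r r' : Pt n} (hr : p ≠ r)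
    (hr' : p ≠ r') (h : (traceOf E).conn s(p, q) s(q, r))
    (h' : (traceOf E).conn s(p, q) s(q, r')) : r = r' := by
  obtain ⟨c, hc, h⟩ := h
  replace h' := conn_of_traceOf_conn hE hc (Curve.left_mem_segs h) h'
  obtain ⟨i, i1, i2, i3, iq, hi⟩ := Curve.conn_cases h hr
  obtain ⟨j, j1, j2, j3, jq, hj⟩ := Curve.conn_cases h' hr'
  have hpq : p ≠ q := (Curve.isSeg_of_mem_segs (Curve.left_mem_segs h)).ne
  have SA := hE.1 c hc
  rcases hi with ⟨ip, ir⟩ | ⟨ir, ip⟩ <;> rcases hj with ⟨jp, jr⟩ | ⟨jr, jp⟩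
  · have := SA (i - 1) (j - 1) i1 (by simpa) j1 (by simpa) (by simp [*])
    obtain rfl : i = j := by omega
    exact ir.symm.trans jr
  · have := SA (i - 1) j i1 (by simpa) j2 j3 (by simp [*, Sym2.eq_swap])
    subst this
    exact absurd (ip.symm.trans jq) hpq
  · have := SA i (j - 1) i2 i3 j1 (by simpa) (by simp [*, Sym2.eq_swap])
    subst this
    exact absurd (jp.symm.trans iq) hpq
  · have := SA i j i2 i3 j2 j3 (by simp [*])
    subst this
    exact ir.symm.trans jr

theorem Curve.exists_endSegAt {c : Curve n} {p : Pt n} (h : c.IsEndpt p) :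
    ∃ S, c.endSegAt p S := by
  obtain ⟨i, hi, rfl, h⟩ := h
  obtain ⟨k, hk, hk'⟩ := c.nontriv
  by_cases h1 : i - 1 ∈ c.dom
  · have h2 : i + 1 ∉ c.dom := by tauto
    exact ⟨_, i, hi, rfl, Or.inr ⟨h2, h1, rfl⟩⟩
  · have h2 : i + 1 ∈ c.dom := by
      have : i ≤ k := by
        by_contra hlt
        exact h1 (c.mem_dom_of_le hk hi (by omega) (by omega))
      exact c.mem_dom_of_le hi hk' (by omega) (by omega)
    exact ⟨_, i, hi, rfl, Or.inl ⟨h1, h2, rfl⟩⟩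

theorem Curve.mem_segs_of_endSegAt {c : Curve n} {p : Pt n} {S : Sym2 (Pt n)}
    (h : c.endSegAt p S) : S ∈ c.segs := by
  obtain ⟨i, hi, -, ⟨-, h1, rfl⟩ | ⟨-, h1, rfl⟩⟩ := h
  · exact ⟨i, hi, h1, rfl⟩
  · exact ⟨i - 1, h1, by simpa, by simp⟩

theorem Curve.mem_of_endSegAt {c : Curve n} {p : Pt n} {S : Sym2 (Pt n)}
    (h : c.endSegAt p S) : p ∈ S := by
  obtain ⟨i, hi, rfl, ⟨-, h1, rfl⟩ | ⟨-, h1, rfl⟩⟩ := h <;> simp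

/-- The part of a curve indexed by an interval `I`. -/
def Curve.restrict (c : Curve n) (I : Set ℤ) (hI : I.OrdConnected)
    (h : ∃ i, i ∈ c.dom ∩ I ∧ i + 1 ∈ c.dom ∩ I) : Curve n where
  dom := c.dom ∩ I
  ordConn := c.ordConn.inter hI
  nontriv := h
  v := c.v
  lattice i hi := c.lattice i hi.1
  step i hi hi' := c.step i hi.1 hi'.1
  noback i hi hi' := c.noback i hi.1 hi'.1

theorem Curve.subCurve_restrict (c : Curve n) (I : Set ℤ) (hI : I.OrdConnected)
    (h : ∃ i, i ∈ c.dom ∩ I ∧ i + 1 ∈ c.dom ∩ I) : SubCurve (c.restrict I hI h) c := by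
  refine ⟨?_, ?_⟩
  · rintro S ⟨i, h1, h2, rfl⟩
    exact ⟨i, h1.1, h2.1, rfl⟩
  · rintro S T ⟨i, h1, h2, h⟩
    exact ⟨i, h1.1, h2.1, h⟩

theorem Curve.SelfAvoiding.finite_index {c : Curve n} (hc : c.SelfAvoiding) (hf : c.segs.Finite) :
    {i : ℤ | i ∈ c.dom ∧ i + 1 ∈ c.dom}.Finite := by
  refine Set.Finite.of_finite_image (f := fun i => s(c.v i, c.v (i + 1))) (hf.subset ?_) ?_
  · rintro _ ⟨i, hi, rfl⟩
    exact ⟨i, hi.1, hi.2, rfl⟩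
  · intro i hi j hj h
    exact hc i j hi.1 hi.2 hj.1 hj.2 h

theorem Curve.SelfAvoiding.nsegs_le {c : Curve n} (hc : c.SelfAvoiding) (hf : c.segs.Finite) :
    c.nsegs ≤ c.segs.ncard := by
  refine Set.ncard_le_ncard_of_injOn (fun i => s(c.v i, c.v (i + 1))) ?_ ?_ hf
  · rintro i hi
    exact ⟨i, hi.1, hi.2, rfl⟩
  · intro i hi j hj h
    exact hc i j hi.1 hi.2 hj.1 hj.2 h

theorem Curve.nsegs_restrict_le {c : Curve n} (hc : c.SelfAvoiding) (hf : c.segs.Finite)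
    (I : Set ℤ) (hI : I.OrdConnected) (h : ∃ i, i ∈ c.dom ∩ I ∧ i + 1 ∈ c.dom ∩ I) :
    (c.restrict I hI h).nsegs ≤ c.nsegs :=
  Set.ncard_le_ncard (fun _ hi => ⟨hi.1.1, hi.2.1⟩) (hc.finite_index hf)

/-- The size of the trace of a curve, counting segments and connexions. -/
def Curve.weight (c : Curve n) : ℕ :=
  c.segs.ncard + {q : Sym2 (Pt n) × Sym2 (Pt n) | c.conn q.1 q.2}.ncard

theorem Curve.finite_conn {c : Curve n} (hf : c.segs.Finite) :
    {q : Sym2 (Pt n) × Sym2 (Pt n) | c.conn q.1 q.2}.Finite :=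
  (hf.prod hf).subset fun _ hq => ⟨Curve.left_mem_segs hq, Curve.right_mem_segs hq⟩

theorem SubCurve.weight_le {b c : Curve n} (h : SubCurve b c) (hf : c.segs.Finite) :
    b.weight ≤ c.weight :=
  add_le_add (Set.ncard_le_ncard h.1 hf)
    (Set.ncard_le_ncard (fun _ hq => h.2 _ _ hq) (Curve.finite_conn hf))

theorem SubCurve.sameCurve {b c : Curve n} (h : SubCurve b c) (hf : c.segs.Finite)
    (hw : c.weight ≤ b.weight) : SameCurve b c := by
  have h1 := Set.ncard_le_ncard h.1 hf
  have hsub : {q : Sym2 (Pt n) × Sym2 (Pt n) | b.conn q.1 q.2} ⊆ {q | c.conn q.1 q.2} :=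
    fun _ hq => h.2 _ _ hq
  have h2 := Set.ncard_le_ncard hsub (Curve.finite_conn hf)
  unfold Curve.weight at hw
  have e1 := Set.eq_of_subset_of_ncard_le h.1 (by omega) hf
  have e2 := Set.eq_of_subset_of_ncard_le hsub (by omega) (Curve.finite_conn hf)
  refine ⟨e1, ?_⟩
  funext S T
  exact congrArg (fun A : Set (Sym2 (Pt n) × Sym2 (Pt n)) => (S, T) ∈ A) e2

theorem SubCurve.trans {a b c : Curve n} (h : SubCurve a b) (h' : SubCurve b c) : SubCurve a c :=
  ⟨h.1.trans h'.1, fun S T hST => h'.2 S T (h.2 S T hST)⟩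

/-- Every subcurve ending at `x` extends to an element of `Σ_{s,x}`. -/
theorem exists_mem_sigmaSet {s : ℕ} {x : Pt n} {E : Set (Curve n)} {D b : Curve n} (hD : D ∈ E)
    (hf : D.segs.Finite) (hb : SubCurve b D) (hx : b.IsEndpt x) (hn : b.nsegs ≤ 8 ^ s) :
    ∃ b' ∈ SigmaSet s x E, SubCurve b b' := by
  let F : Set (Curve n) :=
    {c | SubCurve c D ∧ c.IsEndpt x ∧ c.nsegs ≤ 8 ^ s ∧ SubCurve b c}
  have hbF : b ∈ F := ⟨hb, hx, hn, subset_rfl, fun _ _ h => h⟩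
  have hfin : (Curve.weight '' F).Finite := by
    refine (Set.finite_Iic D.weight).subset ?_
    rintro _ ⟨c, hc, rfl⟩
    exact hc.1.weight_le hf
  obtain ⟨c, hcF, hmax⟩ := Set.exists_max_image (Curve.weight '' F) id hfin ⟨_, b, hbF, rfl⟩
  obtain ⟨c, hc, rfl⟩ := hcF
  refine ⟨c, ⟨D, hD, hc.1, hc.2.1, hc.2.2.1, fun b' h1 h2 h3 h4 => ?_⟩, hc.2.2.2⟩
  exact h4.sameCurve (hf.subset h1.1) (hmax _ ⟨b', ⟨h1, h2, h3, hc.2.2.2.trans h4⟩, rfl⟩)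

theorem sigmaSet_conn {s : ℕ} {E : Set (Curve n)} (hE : DisjSA E) {D : Curve n}
    (hD : D ∈ E) (hf : D.segs.Finite) (hn : D.nsegs ≤ 8 ^ s) {S : Sym2 (Pt n)} {x p q r : Pt n}
    (hS : S ∈ D.segs) (hxS : x ∈ S) (hqx : q ≠ x) (hpr : p ≠ r)
    (h : D.conn s(p, q) s(q, r)) : (traceOf (SigmaSet s x E)).conn s(p, q) s(q, r) := by
  obtain ⟨i, hi, rfl⟩ : ∃ i ∈ D.dom, D.v i = x := by
    obtain ⟨i, h1, h2, rfl⟩ := hS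
    rcases Sym2.mem_iff.1 hxS with h | h
    · exact ⟨i, h1, h.symm⟩
    · exact ⟨i + 1, h2, h.symm⟩
  obtain ⟨j, j1, j2, j3, rfl, hj⟩ := Curve.conn_cases h hpr
  have key : ∀ I : Set ℤ, I.OrdConnected → i ∈ I → j - 1 ∈ I → j ∈ I → j + 1 ∈ I →
      (i - 1 ∉ I ∨ i + 1 ∉ I) → (traceOf (SigmaSet s (D.v i) E)).conn s(p, D.v j) s(D.v j, r) := by
    intro I hI hiI h1 h2 h3 hend
    have hne : ∃ k, k ∈ D.dom ∩ I ∧ k + 1 ∈ D.dom ∩ I := ⟨j, ⟨j2, h2⟩, j3, h3⟩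
    obtain ⟨b, hb, hsub⟩ := exists_mem_sigmaSet (s := s) hD hf (D.subCurve_restrict I hI hne)
      ⟨i, ⟨hi, hiI⟩, rfl, by
        rcases hend with h | h
        · exact Or.inl fun h' => h h'.2
        · exact Or.inr fun h' => h h'.2⟩
      ((Curve.nsegs_restrict_le (hE.1 D hD) hf I hI hne).trans hn)
    refine ⟨b, hb, hsub.2 _ _ ⟨j, ⟨j1, h1⟩, ⟨j3, h3⟩, ?_⟩⟩
    rcases hj with ⟨h, h'⟩ | ⟨h, h'⟩
    · left; simp [Curve.restrict, h, h']
    · right; simp [Curve.restrict, h, h', Sym2.eq_swap]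
  rcases lt_or_gt_of_ne (show i ≠ j by rintro rfl; exact hqx rfl) with hlt | hlt
  · exact key (Set.Ici i) Set.ordConnected_Ici (by simp) (by simp; omega) (by simp; omega)
      (by simp; omega) (by simp)
  · exact key (Set.Iic i) Set.ordConnected_Iic (by simp) (by simp; omega) (by simp; omega)
      (by simp; omega) (by simp)

end Curves

section Blocks

/-- Integer coordinates of the curves of the first block. -/
def intBlock : List (List (ℤ × ℤ × ℤ)) :=
  [ [(0, 0, 0), (0, -1, 0), (0, -1, -1), (0, 0, -1), (1, 0, -1), (1, -1, -1), (1, -1, 0),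
      (1, 0, 0), (2, 0, 0)],
    [(0, 0, 0), (0, 0, 1), (0, 1, 1), (0, 1, 0), (-1, 1, 0), (-1, 1, 1), (-1, 0, 1),
      (-1, 0, 0), (-2, 0, 0)],
    [(0, 0, 0), (0, 0, -1), (-1, 0, -1), (-1, 0, 0), (-1, 1, 0), (-1, 1, -1), (0, 1, -1),
      (0, 1, 0), (0, 2, 0)],
    [(0, 0, 0), (1, 0, 0), (1, 0, 1), (0, 0, 1), (0, -1, 1), (1, -1, 1), (1, -1, 0),
      (0, -1, 0), (0, -2, 0)],
    [(0, 0, 0), (-1, 0, 0), (-1, -1, 0), (0, -1, 0), (0, -1, 1), (-1, -1, 1), (-1, 0, 1),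
      (0, 0, 1), (0, 0, 2)],
    [(0, 0, 0), (0, 1, 0), (1, 1, 0), (1, 0, 0), (1, 0, -1), (1, 1, -1), (0, 1, -1),
      (0, 0, -1), (0, 0, -2)] ]

/-- Integer coordinates of the curves of the four blocks. -/
def intBlocks : List (List (ℤ × ℤ × ℤ)) :=
  intBlock ++ (intBlock.map (List.map fun p => (2 + p.1, 2 - p.2.1, -p.2.2)) ++
    (intBlock.map (List.map fun p => (2 + p.1, p.2.2, 2 - p.2.1)) ++
      intBlock.map (List.map fun p => (p.1, 2 - p.2.2, 2 + p.2.1))))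

/-- The residue modulo 8 of the sum of the endpoints of the `j`-th segment, coded as a number. -/
def segCode (N : List (ℤ × ℤ × ℤ)) (j : ℕ) : ℕ :=
  let p := N.getD j 0 + N.getD (j + 1) 0
  (p.1 % 8).toNat + 8 * (p.2.1 % 8).toNat + 64 * (p.2.2 % 8).toNat

theorem length_of_mem_intBlocks : ∀ N ∈ intBlocks, N.length = 9 := by decide

theorem nodup_segCode :
    (intBlocks.flatMap fun N => (List.range 8).map fun j => segCode N j).Nodup := by
  decide +kernel

theorem turn_ne : ∀ N ∈ intBlocks, ∀ j < 7, N.getD j 0 ≠ N.getD (j + 2) 0 := by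
  decide +kernel

theorem index_of_even : ∀ N ∈ intBlocks, ∀ j < 9,
    (N.getD j 0).1 % 2 = 0 → (N.getD j 0).2.1 % 2 = 0 → (N.getD j 0).2.2 % 2 = 0 →
      j = 0 ∨ j = 8 := by
  decide +kernel

/-- Some turn of `M`, seen from its `i`-th vertex, contradicts a turn of a curve of the first
block seen from the origin. -/
def Conflicting (M : List (ℤ × ℤ × ℤ)) (i : ℕ) : Prop :=
  ∃ j ∈ List.range 7, M.getD (j + 1) 0 ≠ M.getD i 0 ∧ ∃ N ∈ intBlock, ∃ k ∈ List.range 7,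
    N.getD k 0 = M.getD j 0 - M.getD i 0 ∧ N.getD (k + 1) 0 = M.getD (j + 1) 0 - M.getD i 0 ∧
      N.getD (k + 2) 0 ≠ M.getD (j + 2) 0 - M.getD i 0

instance (M : List (ℤ × ℤ × ℤ)) (i : ℕ) : Decidable (Conflicting M i) := by
  unfold Conflicting
  infer_instance

/-- The residue class of a point modulo 4. -/
def residue (z : ℤ × ℤ × ℤ) : ℤ × ℤ × ℤ := (z.1 % 4, z.2.1 % 4, z.2.2 % 4)

theorem exists_conflicting : ∀ a ∈ List.range 4, ∀ b ∈ List.range 4, ∀ c ∈ List.range 4,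
    (a, b, c) ≠ (0, 0, 0) → ∃ M ∈ intBlocks, ∃ i ∈ List.range 9,
      residue (M.getD i 0) = (Int.ofNat a, Int.ofNat b, Int.ofNat c) ∧ Conflicting M i := by
  decide +kernel

end Blocks

section Coordinates

/-- The point of `ℝ³` with given integer coordinates. -/
def emb (z : ℤ × ℤ × ℤ) : Pt 3 := p3 z.1 z.2.1 z.2.2

@[simp] theorem emb_apply_zero (z : ℤ × ℤ × ℤ) : emb z 0 = z.1 := rfl
@[simp] theorem emb_apply_one (z : ℤ × ℤ × ℤ) : emb z 1 = z.2.1 := rfl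
@[simp] theorem emb_apply_two (z : ℤ × ℤ × ℤ) : emb z 2 = z.2.2 := rfl

theorem pt3_ext {p q : Pt 3} (h0 : p 0 = q 0) (h1 : p 1 = q 1) (h2 : p 2 = q 2) : p = q := by
  ext i
  fin_cases i <;> assumption

theorem emb_add (z w : ℤ × ℤ × ℤ) : emb (z + w) = emb z + emb w := by
  apply pt3_ext <;> simp

theorem emb_sub (z w : ℤ × ℤ × ℤ) : emb (z - w) = emb z - emb w := by
  apply pt3_ext <;> simp

theorem emb_zero : emb 0 = 0 := by
  apply pt3_ext <;> simp

theorem smul_emb (m : ℕ) (z : ℤ × ℤ × ℤ) : (m : ℝ) • emb z = emb (m • z) := by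
  apply pt3_ext <;> simp

theorem emb_injective : Function.Injective emb := by
  intro z w h
  have h0 := congrArg (fun p : Pt 3 => p 0) h
  have h1 := congrArg (fun p : Pt 3 => p 1) h
  have h2 := congrArg (fun p : Pt 3 => p 2) h
  simp only [emb_apply_zero, emb_apply_one, emb_apply_two, Int.cast_inj] at h0 h1 h2
  ext <;> assumption

theorem latt_emb (z : ℤ × ℤ × ℤ) : latt (emb z) := by
  intro i
  fin_cases i
  exacts [⟨_, rfl⟩, ⟨_, rfl⟩, ⟨_, rfl⟩]

theorem exists_emb_of_inLat {m : ℕ} {p : Pt 3} (h : inLat m p) : ∃ z, p = (m : ℝ) • emb z := by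
  choose f hf using h
  exact ⟨(f 0, f 1, f 2), pt3_ext (by simp [hf]) (by simp [hf]) (by simp [hf])⟩

theorem exists_emb_of_latt {p : Pt 3} (h : latt p) : ∃ z, p = emb z := by
  choose f hf using h
  exact ⟨(f 0, f 1, f 2), pt3_ext (by simp [hf]) (by simp [hf]) (by simp [hf])⟩

theorem inLat_smul_emb (m : ℕ) (z : ℤ × ℤ × ℤ) : inLat m ((m : ℝ) • emb z) := by
  intro i
  fin_cases i
  exacts [⟨z.1, rfl⟩, ⟨z.2.1, rfl⟩, ⟨z.2.2, rfl⟩]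

theorem inLat_smul {m k : ℕ} {p : Pt 3} (h : inLat k p) : inLat (m * k) ((m : ℝ) • p) := by
  intro i
  obtain ⟨c, hc⟩ := h i
  exact ⟨c, by simp [hc, mul_assoc]⟩

theorem latt_add_uvec {p : Pt 3} (h : latt p) (i : Fin 3) : latt (p + uvec 3 i) := by
  intro j
  obtain ⟨m, hm⟩ := h j
  by_cases hij : j = i
  · subst hij
    exact ⟨m + 1, by simp [uvec, hm]⟩
  · exact ⟨m, by simp [uvec, hm, hij]⟩

theorem IsSeg.latt_left {a b : Pt 3} (h : IsSeg s(a, b)) : latt a := by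
  obtain ⟨x, i, hx, h⟩ := h
  rcases Sym2.eq_iff.1 h with ⟨rfl, -⟩ | ⟨rfl, -⟩
  · exact hx
  · exact latt_add_uvec hx i

theorem IsSeg.latt_right {a b : Pt 3} (h : IsSeg s(a, b)) : latt b :=
  IsSeg.latt_left (Sym2.eq_swap ▸ h)

end Coordinates

section CTrace

/-- The `j`-th segment of the curve `4u + N`. -/
def blockSeg (N : List (ℤ × ℤ × ℤ)) (u : ℤ × ℤ × ℤ) (j : ℕ) : Sym2 (Pt 3) :=
  s(emb (N.getD j 0 + 4 • u), emb (N.getD (j + 1) 0 + 4 • u))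

theorem exists_mem_blockLists {M : List (Pt 3)} :
    (∃ i, M ∈ blockLists i) ↔ ∃ N ∈ intBlocks, M = N.map emb := by
  have h0 : blockLists 0 = intBlock.map (List.map emb) := by
    simp [blockLists, B0, CList, intBlock, emb]
  have hs : ∀ z, p3 2 2 0 + sigma3 (emb z) = emb (2 + z.1, 2 - z.2.1, -z.2.2) := by
    intro z
    apply pt3_ext <;> simp [sigma3, toPt3, p3, sub_eq_add_neg]
  have ht : ∀ z, p3 2 0 2 + tau3 (emb z) = emb (2 + z.1, z.2.2, 2 - z.2.1) := by
    intro z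
    apply pt3_ext <;> simp [tau3, toPt3, p3, sub_eq_add_neg]
  have hu : ∀ z, p3 0 2 2 + ups3 (emb z) = emb (z.1, 2 - z.2.2, 2 + z.2.1) := by
    intro z
    apply pt3_ext <;> simp [ups3, toPt3, p3, sub_eq_add_neg]
  have hB : B0 = intBlock.map (List.map emb) := h0
  have h1 : blockLists 1 = B0.map (List.map fun p => p3 2 2 0 + sigma3 p) := rfl
  have h2 : blockLists 2 = B0.map (List.map fun p => p3 2 0 2 + tau3 p) := rfl
  have h3 : blockLists 3 = B0.map (List.map fun p => p3 0 2 2 + ups3 p) := rfl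
  simp only [Fin.exists_fin_succ, IsEmpty.exists_iff, or_false]
  change M ∈ blockLists 0 ∨ M ∈ blockLists 1 ∨ M ∈ blockLists 2 ∨ M ∈ blockLists 3 ↔ _
  rw [h0, h1, h2, h3, hB]
  simp only [intBlocks, List.mem_append, List.mem_map, or_and_right, exists_or,
    exists_exists_and_eq_and, List.map_map, Function.comp_def, hs, ht, hu, eq_comm (a := M)]

theorem getD_map_emb (N : List (ℤ × ℤ × ℤ)) (j : ℕ) : (N.map emb).getD j 0 = emb (N.getD j 0) := by
  rw [← emb_zero, List.getD_map]

theorem map_add_blockSeg (N : List (ℤ × ℤ × ℤ)) (u : ℤ × ℤ × ℤ) (j : ℕ) :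
    Sym2.map (fun p => p + (4 : ℝ) • emb u)
      s((N.map emb).getD j 0, (N.map emb).getD (j + 1) 0) = blockSeg N u j := by
  have h := smul_emb 4 u
  push_cast at h
  rw [getD_map_emb, getD_map_emb, blockSeg, Sym2.map_mk, emb_add, emb_add, ← h]

theorem CTrace_segs {S : Sym2 (Pt 3)} :
    S ∈ CTrace.segs ↔ ∃ N ∈ intBlocks, ∃ u, ∃ j < 8, S = blockSeg N u j := by
  constructor
  · rintro ⟨u, hu, i, M, hM, S, ⟨j, hj, rfl⟩, rfl⟩
    obtain ⟨u, rfl⟩ := exists_emb_of_latt hu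
    obtain ⟨N, hN, rfl⟩ := exists_mem_blockLists.1 ⟨i, hM⟩
    have := length_of_mem_intBlocks N hN
    refine ⟨N, hN, u, j, ?_, map_add_blockSeg N u j⟩
    simp at hj
    omega
  · rintro ⟨N, hN, u, j, hj, rfl⟩
    obtain ⟨i, hi⟩ := exists_mem_blockLists.2 ⟨N, hN, rfl⟩
    have := length_of_mem_intBlocks N hN
    exact ⟨emb u, latt_emb u, i, _, hi, _, ⟨j, by simp; omega, rfl⟩, map_add_blockSeg N u j⟩

theorem CTrace_conn {S T : Sym2 (Pt 3)} :
    CTrace.conn S T ↔ ∃ N ∈ intBlocks, ∃ u, ∃ j < 7,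
      (S = blockSeg N u j ∧ T = blockSeg N u (j + 1)) ∨
      (T = blockSeg N u j ∧ S = blockSeg N u (j + 1)) := by
  constructor
  · rintro ⟨u, hu, i, M, hM, S, T, ⟨j, hj, h⟩, rfl, rfl⟩
    obtain ⟨u, rfl⟩ := exists_emb_of_latt hu
    obtain ⟨N, hN, rfl⟩ := exists_mem_blockLists.1 ⟨i, hM⟩
    have := length_of_mem_intBlocks N hN
    refine ⟨N, hN, u, j, ?_, ?_⟩
    · simp at hj
      omega
    · rcases h with ⟨rfl, rfl⟩ | ⟨rfl, rfl⟩
      · exact Or.inl ⟨map_add_blockSeg N u j, map_add_blockSeg N u (j + 1)⟩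
      · exact Or.inr ⟨map_add_blockSeg N u j, map_add_blockSeg N u (j + 1)⟩
  · rintro ⟨N, hN, u, j, hj, h⟩
    obtain ⟨i, hi⟩ := exists_mem_blockLists.2 ⟨N, hN, rfl⟩
    have := length_of_mem_intBlocks N hN
    have hj' : j + 2 < (N.map emb).length := by simp; omega
    rcases h with ⟨rfl, rfl⟩ | ⟨rfl, rfl⟩
    · exact ⟨emb u, latt_emb u, i, _, hi, _, _, ⟨j, hj', Or.inl ⟨rfl, rfl⟩⟩,
        (map_add_blockSeg N u j).symm, (map_add_blockSeg N u (j + 1)).symm⟩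
    · exact ⟨emb u, latt_emb u, i, _, hi, _, _, ⟨j, hj', Or.inr ⟨rfl, rfl⟩⟩,
        (map_add_blockSeg N u (j + 1)).symm, (map_add_blockSeg N u j).symm⟩

theorem blockSeg_add (N : List (ℤ × ℤ × ℤ)) (u w : ℤ × ℤ × ℤ) (j : ℕ) :
    Sym2.map (fun p => p + emb (4 • w)) (blockSeg N u j) = blockSeg N (u + w) j := by
  simp only [blockSeg, Sym2.map_mk, ← emb_add, smul_add, add_assoc]

theorem blockSeg_inj {N N' : List (ℤ × ℤ × ℤ)} {u u' : ℤ × ℤ × ℤ} {j j' : ℕ}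
    (hN : N ∈ intBlocks) (hN' : N' ∈ intBlocks) (hj : j < 8) (hj' : j' < 8)
    (h : blockSeg N u j = blockSeg N' u' j') : N = N' ∧ u = u' := by
  have hsum : N.getD j 0 + N.getD (j + 1) 0 + 8 • u
      = N'.getD j' 0 + N'.getD (j' + 1) 0 + 8 • u' := by
    have e : ∀ p q u : ℤ × ℤ × ℤ, p + q + 8 • u = (p + 4 • u) + (q + 4 • u) := by
      intro p q u
      rw [show 8 • u = 4 • u + 4 • u by rw [← add_smul]]
      abel
    rw [e, e]
    rcases Sym2.eq_iff.1 h with ⟨h1, h2⟩ | ⟨h1, h2⟩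
    · rw [emb_injective h1, emb_injective h2]
    · rw [emb_injective h1, emb_injective h2, add_comm]
  have hcode : segCode N j = segCode N' j' := by
    have h1 := congrArg (fun p => p.1) hsum
    have h2 := congrArg (fun p => p.2.1) hsum
    have h3 := congrArg (fun p => p.2.2) hsum
    simp only [Prod.fst_add, Prod.snd_add, Prod.smul_fst, Prod.smul_snd] at h1 h2 h3
    simp only [nsmul_eq_mul, Nat.cast_ofNat] at h1 h2 h3
    simp only [segCode, Prod.fst_add, Prod.snd_add]
    omega
  have hnd := List.nodup_flatMap.1 nodup_segCode
  have hNN : N = N' := by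
    by_contra hne
    have hs : Std.Symm (Function.onFun List.Disjoint
        fun N => (List.range 8).map fun j => segCode N j) := ⟨fun _ _ h => h.symm⟩
    have hd : List.Disjoint ((List.range 8).map fun j => segCode N j)
        ((List.range 8).map fun j => segCode N' j) := hnd.2.forall hN hN' hne
    exact hd (List.mem_map.2 ⟨j, by simpa using hj, rfl⟩)
      (List.mem_map.2 ⟨j', by simpa using hj', hcode.symm⟩)
  subst hNN
  have hjj : j = j' :=
    List.inj_on_of_nodup_map (hnd.1 N hN) (by simpa using hj) (by simpa using hj') hcode
  subst hjj
  refine ⟨rfl, ?_⟩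
  have h8 := add_left_cancel hsum
  ext
  · have := congrArg (fun p => p.1) h8
    simpa using this
  · have := congrArg (fun p => p.2.1) h8
    simpa using this
  · have := congrArg (fun p => p.2.2) h8
    simpa using this

/-- The segments of the curve `4u + N`. -/
def blockSegs (N : List (ℤ × ℤ × ℤ)) (u : ℤ × ℤ × ℤ) : Set (Sym2 (Pt 3)) :=
  {S | ∃ j < 8, S = blockSeg N u j}

theorem finite_blockSegs (N : List (ℤ × ℤ × ℤ)) (u : ℤ × ℤ × ℤ) :
    (blockSegs N u).Finite ∧ (blockSegs N u).ncard ≤ 8 := by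
  have h : blockSegs N u = ((Finset.range 8).image (blockSeg N u) : Set (Sym2 (Pt 3))) := by
    ext S
    simp [blockSegs, eq_comm]
  rw [h]
  refine ⟨Set.toFinite _, ?_⟩
  rw [Set.ncard_coe_finset]
  exact Finset.card_image_le.trans (by simp)

/-- A vertex of `4u + N` with even coordinates is an endpoint. -/
theorem eq_end_of_even {N : List (ℤ × ℤ × ℤ)} (hN : N ∈ intBlocks) {u a : ℤ × ℤ × ℤ} {j : ℕ}
    (hj : j < 9) (h : emb (2 • a) = emb (N.getD j 0 + 4 • u)) : j = 0 ∨ j = 8 := by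
  have h := emb_injective h
  have h1 := congrArg (fun p => p.1) h
  have h2 := congrArg (fun p => p.2.1) h
  have h3 := congrArg (fun p => p.2.2) h
  simp only [Prod.fst_add, Prod.snd_add, Prod.smul_fst, Prod.smul_snd] at h1 h2 h3
  simp only [nsmul_eq_mul, Nat.cast_ofNat] at h1 h2 h3
  exact index_of_even N hN j hj (by omega) (by omega) (by omega)

/-- Curves of `𝒞` are not connected at points of `2ℤ³`. -/
theorem not_CTrace_conn_of_even (a : ℤ × ℤ × ℤ) {p r : Pt 3} (hpr : p ≠ r) :
    ¬ CTrace.conn s(p, emb (2 • a)) s(emb (2 • a), r) := by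
  intro h
  obtain ⟨N, hN, u, j, hj, h⟩ := CTrace_conn.1 h
  have hmid : emb (2 • a) = emb (N.getD (j + 1) 0 + 4 • u) := by
    simp only [blockSeg, Sym2.eq_iff] at h
    grind
  have := eq_end_of_even hN (by omega) hmid
  omega

end CTrace

section Covering

variable {C3 : Set (Curve 3)}

/-- `S` belongs to a curve of `C3` joining the images of the endpoints of `R` under the
homothety of ratio 2. -/
def Over (C3 : Set (Curve 3)) (R S : Sym2 (Pt 3)) : Prop :=
  ∃ a b, R = s(a, b) ∧ ∃ c ∈ C3, c.IsEndpt (((2 : ℕ) : ℝ) • a) ∧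
    c.IsEndpt (((2 : ℕ) : ℝ) • b) ∧ S ∈ c.segs

theorem segs_subset_blockSegs (hC3 : traceOf C3 = CTrace) {c : Curve 3} (hc : c ∈ C3)
    {N : List (ℤ × ℤ × ℤ)} (hN : N ∈ intBlocks) {u : ℤ × ℤ × ℤ} {S : Sym2 (Pt 3)}
    (hS : S ∈ c.segs) (hSN : S ∈ blockSegs N u) : c.segs ⊆ blockSegs N u := by
  intro S' hS'
  have hchain := Curve.reflTransGen_conn hS hS'
  clear hS'
  induction hchain with
  | refl => exact hSN
  | @tail T T' _ h ih =>
    have h' : CTrace.conn T T' := hC3 ▸ ⟨c, hc, h⟩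
    obtain ⟨k, hk, hT⟩ := ih
    obtain ⟨N', hN', u', j, hj, h'⟩ := CTrace_conn.1 h'
    rcases h' with ⟨h1, h2⟩ | ⟨h2, h1⟩
    · obtain ⟨rfl, rfl⟩ := blockSeg_inj hN hN' hk (by omega) (hT.symm.trans h1)
      exact ⟨j + 1, by omega, h2⟩
    · obtain ⟨rfl, rfl⟩ := blockSeg_inj hN hN' hk (by omega) (hT.symm.trans h1)
      exact ⟨j, by omega, h2⟩

theorem exists_blockSegs (hC3 : traceOf C3 = CTrace) {c : Curve 3} (hc : c ∈ C3)
    {S : Sym2 (Pt 3)} (hS : S ∈ c.segs) :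
    ∃ N ∈ intBlocks, ∃ u, S ∈ blockSegs N u ∧ c.segs ⊆ blockSegs N u := by
  have h : S ∈ CTrace.segs := hC3 ▸ ⟨c, hc, hS⟩
  obtain ⟨N, hN, u, j, hj, h⟩ := CTrace_segs.1 h
  exact ⟨N, hN, u, ⟨j, hj, h⟩, segs_subset_blockSegs hC3 hc hN hS ⟨j, hj, h⟩⟩

theorem eq_end_of_isEndpt {c : Curve 3} {N : List (ℤ × ℤ × ℤ)} (hN : N ∈ intBlocks)
    {u : ℤ × ℤ × ℤ} (hcN : c.segs ⊆ blockSegs N u) {a : Pt 3} (ha : latt a)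
    (h : c.IsEndpt (((2 : ℕ) : ℝ) • a)) :
    ((2 : ℕ) : ℝ) • a = emb (N.getD 0 0 + 4 • u) ∨
      ((2 : ℕ) : ℝ) • a = emb (N.getD 8 0 + 4 • u) := by
  obtain ⟨z, rfl⟩ := exists_emb_of_latt ha
  rw [smul_emb] at h ⊢
  obtain ⟨S, hS⟩ := Curve.exists_endSegAt h
  obtain ⟨j, hj, rfl⟩ := hcN (Curve.mem_segs_of_endSegAt hS)
  rcases Sym2.mem_iff.1 (Curve.mem_of_endSegAt hS) with h | h
  · rcases eq_end_of_even hN (by omega) h with rfl | rfl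
    · exact Or.inl h
    · exact Or.inr h
  · rcases eq_end_of_even hN (by omega) h with h' | h'
    · omega
    · rw [h'] at h
      exact Or.inr h

theorem two_smul_injective {a b : Pt 3} (h : ((2 : ℕ) : ℝ) • a = ((2 : ℕ) : ℝ) • b) : a = b :=
  smul_right_injective (Pt 3) (by norm_num : ((2 : ℕ) : ℝ) ≠ 0) h

theorem two_smul_emb_two_smul (w : ℤ × ℤ × ℤ) :
    ((2 : ℕ) : ℝ) • emb (2 • w) = emb (4 • w) := by
  rw [smul_emb, smul_smul]
  rfl

/-- The segment of which a segment of a curve of `C3` is a part after the homothety is unique,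
compatibly with the translations of `4ℤ³`. -/
theorem Over.unique (hC3 : traceOf C3 = CTrace) {R R' S : Sym2 (Pt 3)} (w : ℤ × ℤ × ℤ)
    (hR : IsSeg R) (hR' : IsSeg R') (h : Over C3 R S)
    (h' : Over C3 R' (Sym2.map (fun p => p + emb (4 • w)) S)) :
    R' = Sym2.map (fun p => p + emb (2 • w)) R := by
  obtain ⟨a, b, rfl, c, hc, ha, hb, hS⟩ := h
  obtain ⟨a', b', rfl, c', hc', ha', hb', hS'⟩ := h'
  obtain ⟨N, hN, u, ⟨j, hj, rfl⟩, hcN⟩ := exists_blockSegs hC3 hc hS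
  rw [blockSeg_add] at hS'
  have hcN' := segs_subset_blockSegs hC3 hc' hN hS' ⟨j, hj, rfl⟩
  have e := two_smul_emb_two_smul w
  have shift : ∀ (z : ℤ × ℤ × ℤ) (p q : Pt 3), ((2 : ℕ) : ℝ) • p = emb (z + 4 • u) →
      ((2 : ℕ) : ℝ) • q = emb (z + 4 • (u + w)) → q = p + emb (2 • w) := by
    intro z p q hp hq
    apply two_smul_injective
    rw [smul_add, e, hp, hq, ← emb_add, smul_add, add_assoc]
  have hne : a ≠ b := hR.ne
  have hne' : a' ≠ b' := hR'.ne
  rw [Sym2.map_mk, Sym2.eq_iff]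
  rcases eq_end_of_isEndpt hN hcN hR.latt_left ha with h1 | h1 <;>
  rcases eq_end_of_isEndpt hN hcN hR.latt_right hb with h2 | h2 <;>
  rcases eq_end_of_isEndpt hN hcN' hR'.latt_left ha' with h3 | h3 <;>
  rcases eq_end_of_isEndpt hN hcN' hR'.latt_right hb' with h4 | h4 <;>
  first
    | exact absurd (two_smul_injective (h1.trans h2.symm)) hne
    | exact absurd (two_smul_injective (h3.trans h4.symm)) hne'
    | exact Or.inl ⟨shift _ _ _ h1 h3, shift _ _ _ h2 h4⟩
    | exact Or.inr ⟨shift _ _ _ h2 h3, shift _ _ _ h1 h4⟩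

theorem Over.unique' (hC3 : traceOf C3 = CTrace) {R R' S : Sym2 (Pt 3)}
    (hR : IsSeg R) (hR' : IsSeg R') (h : Over C3 R S) (h' : Over C3 R' S) : R' = R := by
  have := Over.unique hC3 0 hR hR' h (by simpa [emb_zero] using h')
  simpa [emb_zero] using this

theorem exists_curve_of_isSeg (hH : SatH C3 2 4) {a b : Pt 3} (h : IsSeg s(a, b)) :
    ∃ c ∈ C3, c.IsEndpt (((2 : ℕ) : ℝ) • a) ∧ c.IsEndpt (((2 : ℕ) : ℝ) • b) := by
  obtain ⟨x, i, hx, h⟩ := h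
  obtain ⟨z, rfl⟩ := exists_emb_of_latt hx
  have hl : latt (((2 : ℕ) : ℝ) • emb z) := by
    rw [smul_emb]
    exact latt_emb _
  obtain ⟨c, hc, h1, h2⟩ := (hH.2.2.2.2.2.1 _ i hl (inLat_smul_emb 2 z)).1
  rw [← smul_add] at h2
  rcases Sym2.eq_iff.1 h with ⟨rfl, rfl⟩ | ⟨rfl, rfl⟩
  · exact ⟨c, hc, h1, h2⟩
  · exact ⟨c, hc, h2, h1⟩

theorem sameCurve_of_isEndpt (hH : SatH C3 2 4) {a b : Pt 3} (h : IsSeg s(a, b)) {c d : Curve 3}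
    (hc : c ∈ C3) (hd : d ∈ C3) (hca : c.IsEndpt (((2 : ℕ) : ℝ) • a))
    (hcb : c.IsEndpt (((2 : ℕ) : ℝ) • b)) (hda : d.IsEndpt (((2 : ℕ) : ℝ) • a))
    (hdb : d.IsEndpt (((2 : ℕ) : ℝ) • b)) : SameCurve c d := by
  obtain ⟨x, i, hx, h⟩ := h
  obtain ⟨z, rfl⟩ := exists_emb_of_latt hx
  have hl : latt (((2 : ℕ) : ℝ) • emb z) := by
    rw [smul_emb]
    exact latt_emb _
  have key := (hH.2.2.2.2.2.1 _ i hl (inLat_smul_emb 2 z)).2 c hc d hd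
  rw [← smul_add] at key
  rcases Sym2.eq_iff.1 h with ⟨rfl, rfl⟩ | ⟨rfl, rfl⟩
  · exact key hca hcb hda hdb
  · exact key hcb hca hdb hda

theorem exists_over (hH : SatH C3 2 4) {S : Sym2 (Pt 3)} (hS : IsSeg S) :
    ∃ R, IsSeg R ∧ Over C3 R S := by
  have hne : (segPts S ∩ Set.univ).Nonempty := by
    induction S using Sym2.ind with
    | _ a b => exact ⟨a, ⟨a, b, rfl, 0, le_rfl, zero_le_one, by simp⟩, trivial⟩
  obtain ⟨c, hc, hSc⟩ := (hH.2.2.2.1.2 S hS hne).1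
  obtain ⟨-, x, i, -, hx, h1, h2, -⟩ := hH.2.2.2.2.1 c hc
  obtain ⟨z, rfl⟩ := exists_emb_of_inLat hx
  rw [← smul_add] at h2
  exact ⟨_, ⟨emb z, i, latt_emb z, rfl⟩, _, _, rfl, c, hc, h1, h2, hSc⟩

theorem finite_over (hC3 : traceOf C3 = CTrace) (hH : SatH C3 2 4) {R : Sym2 (Pt 3)}
    (hR : IsSeg R) : ∃ G : Finset (Sym2 (Pt 3)), G.card ≤ 8 ∧ ∀ S, Over C3 R S → S ∈ G := by
  induction R using Sym2.ind with
  | _ a b =>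
    obtain ⟨c, hc, ha, hb⟩ := exists_curve_of_isSeg hH hR
    obtain ⟨S, hS⟩ := Curve.exists_endSegAt ha
    obtain ⟨N, hN, u, -, hcN⟩ := exists_blockSegs hC3 hc (Curve.mem_segs_of_endSegAt hS)
    obtain ⟨hf, hcard⟩ := finite_blockSegs N u
    refine ⟨hf.toFinset, by rwa [← Set.ncard_eq_toFinset_card _ hf], ?_⟩
    rintro T ⟨a', b', h, c', hc', ha', hb', hT⟩
    have hsame : SameCurve c' c := by
      rcases Sym2.eq_iff.1 h with ⟨rfl, rfl⟩ | ⟨rfl, rfl⟩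
      · exact sameCurve_of_isEndpt hH hR hc' hc ha' hb' ha hb
      · exact sameCurve_of_isEndpt hH hR hc' hc hb' ha' ha hb
    rw [Set.Finite.mem_toFinset]
    exact hcN (hsame.1 ▸ hT)

end Covering

section Powers

variable {C3 : Set (Curve 3)} {P : ℕ → Set (Curve 3)}

theorem isSeg_of_mem {n : ℕ} {E : Set (Curve n)} {S : Sym2 (Pt n)} (h : S ∈ (traceOf E).segs) :
    IsSeg S := by
  obtain ⟨c, -, h⟩ := h
  exact Curve.isSeg_of_mem_segs h

theorem PowersOf.mem_segs (hH : SatH C3 2 4) (hP : PowersOf C3 2 P) :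
    ∀ (s : ℕ) {S : Sym2 (Pt 3)}, IsSeg S → S ∈ (traceOf (P s)).segs
  | 0, S, hS => by
    rw [hP.2.1]
    exact hS
  | s + 1, S, hS => by
    rw [hP.2.2]
    obtain ⟨_, hR, a, b, rfl, h⟩ := exists_over hH hS
    exact ⟨a, b, hP.mem_segs hH s hR, h⟩

theorem PowersOf.conn_of_curve (hH : SatH C3 2 4) (hP : PowersOf C3 2 P) (s : ℕ)
    {a b : Pt 3} (hR : IsSeg s(a, b)) {c : Curve 3} (hc : c ∈ C3)
    (ha : c.IsEndpt (((2 : ℕ) : ℝ) • a)) (hb : c.IsEndpt (((2 : ℕ) : ℝ) • b))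
    {S T : Sym2 (Pt 3)} (h : c.conn S T) : (traceOf (P (s + 1))).conn S T := by
  rw [hP.2.2]
  exact Or.inl ⟨a, b, hP.mem_segs hH s hR, c, hc, ha, hb, h⟩

theorem PowersOf.conn_of_CTrace (hC3 : traceOf C3 = CTrace) (hH : SatH C3 2 4)
    (hP : PowersOf C3 2 P) (s : ℕ) {S T : Sym2 (Pt 3)} (h : CTrace.conn S T) :
    (traceOf (P (s + 1))).conn S T := by
  rw [← hC3] at h
  obtain ⟨c, hc, h⟩ := h
  obtain ⟨-, x, i, -, hx, h1, h2, -⟩ := hH.2.2.2.2.1 c hc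
  obtain ⟨z, rfl⟩ := exists_emb_of_inLat hx
  rw [← smul_add] at h2
  exact hP.conn_of_curve hH s ⟨emb z, i, latt_emb z, rfl⟩ hc h1 h2 h

theorem PowersOf.chain_of_over (hH : SatH C3 2 4) (hP : PowersOf C3 2 P) (s : ℕ)
    {R S S' : Sym2 (Pt 3)} (hR : IsSeg R) (hS : Over C3 R S) (hS' : Over C3 R S') :
    Relation.ReflTransGen (traceOf (P (s + 1))).conn S S' := by
  obtain ⟨a, b, rfl, c, hc, ha, hb, hS⟩ := hS
  obtain ⟨a', b', h, c', hc', ha', hb', hS'⟩ := hS'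
  have hsame : SameCurve c' c := by
    rcases Sym2.eq_iff.1 h with ⟨rfl, rfl⟩ | ⟨rfl, rfl⟩
    · exact sameCurve_of_isEndpt hH hR hc' hc ha' hb' ha hb
    · exact sameCurve_of_isEndpt hH hR hc' hc hb' ha' ha hb
  exact Relation.ReflTransGen.mono (fun _ _ h => hP.conn_of_curve hH s hR hc ha hb h) _ _
    (Curve.reflTransGen_conn hS (hsame.1 ▸ hS'))

theorem exists_vertices_of_conn {n : ℕ} {E : Set (Curve n)} {S T : Sym2 (Pt n)}
    (h : (traceOf E).conn S T) : ∃ a b d, S = s(a, b) ∧ T = s(b, d) := by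
  obtain ⟨c, -, i, -, -, ⟨rfl, rfl⟩ | ⟨rfl, rfl⟩⟩ := h
  · exact ⟨_, _, _, rfl, rfl⟩
  · exact ⟨_, _, _, Sym2.eq_swap, Sym2.eq_swap⟩

theorem isSeg_of_conn {n : ℕ} {E : Set (Curve n)} {S T : Sym2 (Pt n)}
    (h : (traceOf E).conn S T) : IsSeg S ∧ IsSeg T := by
  obtain ⟨c, -, h⟩ := h
  exact ⟨Curve.isSeg_of_mem_segs (Curve.left_mem_segs h),
    Curve.isSeg_of_mem_segs (Curve.right_mem_segs h)⟩

/-- A connexion of `𝒞^s` lifts to a connexion of `𝒞^{s+1}`. -/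
theorem PowersOf.exists_conn_lift (hH : SatH C3 2 4) (hP : PowersOf C3 2 P) (s : ℕ)
    {a b d : Pt 3} (h : (traceOf (P s)).conn s(a, b) s(b, d)) :
    ∃ A B, Over C3 s(a, b) A ∧ Over C3 s(b, d) B ∧ ((2 : ℕ) : ℝ) • b ∈ A ∧
      ((2 : ℕ) : ℝ) • b ∈ B ∧ (traceOf (P (s + 1))).conn A B := by
  obtain ⟨h1, h2⟩ := isSeg_of_conn h
  obtain ⟨c, hc, ca, cb⟩ := exists_curve_of_isSeg hH h1
  obtain ⟨c', hc', cb', cd⟩ := exists_curve_of_isSeg hH h2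
  obtain ⟨A, hA⟩ := Curve.exists_endSegAt cb
  obtain ⟨B, hB⟩ := Curve.exists_endSegAt cb'
  refine ⟨A, B, ⟨a, b, rfl, c, hc, ca, cb, Curve.mem_segs_of_endSegAt hA⟩,
    ⟨b, d, rfl, c', hc', cb', cd, Curve.mem_segs_of_endSegAt hB⟩,
    Curve.mem_of_endSegAt hA, Curve.mem_of_endSegAt hB, ?_⟩
  rw [hP.2.2]
  exact Or.inr ⟨a, b, d, h, c, hc, c', hc', ca, cb, cb', cd, Or.inl ⟨hA, hB⟩⟩

theorem PowersOf.chain_lift (hH : SatH C3 2 4) (hP : PowersOf C3 2 P) (s : ℕ)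
    {R R' S S' : Sym2 (Pt 3)} (hR : IsSeg R)
    (h : Relation.ReflTransGen (traceOf (P s)).conn R R')
    (hS : Over C3 R S) (hS' : Over C3 R' S') :
    Relation.ReflTransGen (traceOf (P (s + 1))).conn S S' := by
  induction h generalizing S' with
  | refl => exact hP.chain_of_over hH s hR hS hS'
  | tail _ hc ih =>
    obtain ⟨a, b, d, rfl, rfl⟩ := exists_vertices_of_conn hc
    obtain ⟨A, B, hA, hB, -, -, hAB⟩ := hP.exists_conn_lift hH s hc
    exact ((ih hA).tail hAB).trans (hP.chain_of_over hH s (isSeg_of_conn hc).2 hB hS')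

/-- A connexion of `𝒞^{s+1}` lies in a curve of `𝒞` or comes from a connexion of `𝒞^s`. -/
theorem PowersOf.conn_cases (hP : PowersOf C3 2 P) (s : ℕ) {S T : Sym2 (Pt 3)}
    (h : (traceOf (P (s + 1))).conn S T) :
    (∃ R, IsSeg R ∧ Over C3 R S ∧ Over C3 R T ∧ (traceOf C3).conn S T) ∨
      ∃ R R', (traceOf (P s)).conn R R' ∧ Over C3 R S ∧ Over C3 R' T := by
  rw [hP.2.2] at h
  rcases h with ⟨a, b, hR, c, hc, ha, hb, h⟩ | ⟨a, b, d, h, c, hc, c', hc', ca, cb, cb', cd, h'⟩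
  · exact Or.inl ⟨s(a, b), isSeg_of_mem hR,
      ⟨a, b, rfl, c, hc, ha, hb, Curve.left_mem_segs h⟩,
      ⟨a, b, rfl, c, hc, ha, hb, Curve.right_mem_segs h⟩, c, hc, h⟩
  · right
    rcases h' with ⟨hS, hT⟩ | ⟨hT, hS⟩
    · exact ⟨_, _, h, ⟨a, b, rfl, c, hc, ca, cb, Curve.mem_segs_of_endSegAt hS⟩,
        ⟨b, d, rfl, c', hc', cb', cd, Curve.mem_segs_of_endSegAt hT⟩⟩
    · exact ⟨_, _, traceOf_conn_symm h,
        ⟨b, d, rfl, c', hc', cb', cd, Curve.mem_segs_of_endSegAt hS⟩,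
        ⟨a, b, rfl, c, hc, ca, cb, Curve.mem_segs_of_endSegAt hT⟩⟩

theorem PowersOf.chain_project (hC3 : traceOf C3 = CTrace) (hP : PowersOf C3 2 P) (s : ℕ)
    {R S S' : Sym2 (Pt 3)} (hR : IsSeg R) (hS : Over C3 R S)
    (h : Relation.ReflTransGen (traceOf (P (s + 1))).conn S S') :
    ∃ R', IsSeg R' ∧ Relation.ReflTransGen (traceOf (P s)).conn R R' ∧ Over C3 R' S' := by
  induction h with
  | refl => exact ⟨R, hR, Relation.ReflTransGen.refl, hS⟩
  | tail _ hc ih =>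
    obtain ⟨R', hR', hchain, hT⟩ := ih
    rcases hP.conn_cases s hc with ⟨Q, hQ, h1, h2, -⟩ | ⟨Q, Q', hQ, h1, h2⟩
    · obtain rfl := Over.unique' hC3 hQ hR' h1 hT
      exact ⟨_, hR', hchain, h2⟩
    · obtain rfl := Over.unique' hC3 (isSeg_of_conn hQ).1 hR' h1 hT
      exact ⟨Q', (isSeg_of_conn hQ).2, hchain.tail hQ, h2⟩

open Classical in
theorem PowersOf.finite_chain (hC3 : traceOf C3 = CTrace) (hH : SatH C3 2 4)
    (hP : PowersOf C3 2 P) : ∀ (s : ℕ) {S : Sym2 (Pt 3)}, IsSeg S →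
      ∃ K : Finset (Sym2 (Pt 3)), K.card ≤ 8 ^ s ∧
        ∀ S', Relation.ReflTransGen (traceOf (P s)).conn S S' → S' ∈ K
  | 0, S, _ => by
    refine ⟨{S}, by simp, fun S' h => ?_⟩
    rw [hP.2.1] at h
    induction h with
    | refl => simp
    | tail _ h _ => exact h.elim
  | s + 1, S, hS => by
    obtain ⟨R, hR, hRS⟩ := exists_over hH hS
    obtain ⟨K, hK, hmem⟩ := hP.finite_chain hC3 hH s hR
    have hG : ∀ Q, ∃ G : Finset (Sym2 (Pt 3)),
        G.card ≤ 8 ∧ (IsSeg Q → ∀ T, Over C3 Q T → T ∈ G) := by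
      intro Q
      by_cases hQ : IsSeg Q
      · obtain ⟨G, h1, h2⟩ := finite_over hC3 hH hQ
        exact ⟨G, h1, fun _ => h2⟩
      · exact ⟨∅, by simp, fun h => absurd h hQ⟩
    choose G hG8 hG using hG
    refine ⟨K.biUnion G, ?_, fun S' h => ?_⟩
    · calc (K.biUnion G).card ≤ K.card * 8 := Finset.card_biUnion_le_card_mul _ _ _ fun Q _ => hG8 Q
        _ ≤ 8 ^ s * 8 := Nat.mul_le_mul_right _ hK
        _ = 8 ^ (s + 1) := (pow_succ ..).symm
    · obtain ⟨R', hR', hchain, hT⟩ := hP.chain_project hC3 s hR hRS h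
      exact Finset.mem_biUnion.2 ⟨R', hmem R' hchain, hG R' hR' S' hT⟩

theorem PowersOf.finite_segs (hC3 : traceOf C3 = CTrace) (hH : SatH C3 2 4)
    (hP : PowersOf C3 2 P) {s : ℕ} {D : Curve 3} (hD : D ∈ P s) :
    D.segs.Finite ∧ D.nsegs ≤ 8 ^ s := by
  obtain ⟨i, hi, hi'⟩ := D.nontriv
  have hS : s(D.v i, D.v (i + 1)) ∈ D.segs := ⟨i, hi, hi', rfl⟩
  obtain ⟨K, hK, hmem⟩ := hP.finite_chain hC3 hH s (Curve.isSeg_of_mem_segs hS)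
  have hsub : D.segs ⊆ K := fun T hT =>
    hmem T
    (Relation.ReflTransGen.mono (fun _ _ h => ⟨D, hD, h⟩) _ _ (Curve.reflTransGen_conn hS hT))
  have hf : D.segs.Finite := K.finite_toSet.subset hsub
  refine ⟨hf, (((hP.1 s).1 D hD).nsegs_le hf).trans (le_trans ?_ hK)⟩
  rw [← Set.ncard_coe_finset]
  exact Set.ncard_le_ncard hsub K.finite_toSet

/-- Each connexion of a curve of `T` through `x`, made at a point other than `x`, also exists
in `x + T`. -/
def MatchesAt (T : Trace 3) (x : Pt 3) : Prop :=
  ∀ S ∈ T.segs, x ∈ S → ∀ p q r : Pt 3, p ≠ r → q ≠ x →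
    Relation.ReflTransGen T.conn S s(p, q) → T.conn s(p, q) s(q, r) →
      T.conn s(p - x, q - x) s(q - x, r - x)

theorem PowersOf.matchesAt_of_tprec (hC3 : traceOf C3 = CTrace) (hH : SatH C3 2 4)
    (hP : PowersOf C3 2 P) {s : ℕ} {x : Pt 3}
    (h : TPrec (traceOf (SigmaSet s x (P s))) (Trace.transl x (traceOf (SigmaSet s 0 (P s))))) :
    MatchesAt (traceOf (P s)) x := by
  rintro S ⟨D, hD, hS⟩ hxS p q r hpr hqx hchain hconn
  obtain ⟨hf, hn⟩ := hP.finite_segs hC3 hH hD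
  have hD' := conn_of_traceOf_conn (hP.1 s) hD (mem_segs_of_chain (hP.1 s) hD hS hchain) hconn
  obtain ⟨A, B, ⟨b, ⟨D', hD', hb, -⟩, hAB⟩, hA, hB⟩ :=
    h.2 _ _ (sigmaSet_conn (hP.1 s) hD hf hn hS hxS hqx hpr hD')
  have back : ∀ Q, Sym2.map (fun p => p - x) (Sym2.map (fun p => p + x) Q) = Q := by
    intro Q
    simp [Sym2.map_map]
  have hA' := congrArg (Sym2.map fun p => p - x) hA
  have hB' := congrArg (Sym2.map fun p => p - x) hB
  rw [back, Sym2.map_mk] at hA' hB'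
  rw [hA', hB']
  exact ⟨D', hD', hb.2 _ _ hAB⟩

/-- Consecutive segments of `4u + N` are connected. -/
theorem CTrace_conn_turn {N : List (ℤ × ℤ × ℤ)} (hN : N ∈ intBlocks) (u : ℤ × ℤ × ℤ) {j : ℕ}
    (hj : j < 7) : CTrace.conn (blockSeg N u j) (blockSeg N u (j + 1)) :=
  CTrace_conn.2 ⟨N, hN, u, j, hj, Or.inl ⟨rfl, rfl⟩⟩

theorem blockSeg_chain {N : List (ℤ × ℤ × ℤ)} (hN : N ∈ intBlocks) (u : ℤ × ℤ × ℤ) {i j : ℕ}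
    (hi : i < 8) (hj : j < 8) :
    Relation.ReflTransGen CTrace.conn (blockSeg N u i) (blockSeg N u j) := by
  have key : ∀ j < 8, Relation.ReflTransGen CTrace.conn (blockSeg N u 0) (blockSeg N u j) := by
    intro j hj
    induction j with
    | zero => exact Relation.ReflTransGen.refl
    | succ j ih => exact (ih (by omega)).tail (CTrace_conn_turn hN u (by omega))
  have hsymm : Std.Symm CTrace.conn := by
    refine ⟨fun S T h => ?_⟩
    obtain ⟨N, hN, u, j, hj, h⟩ := CTrace_conn.1 h
    exact CTrace_conn.2 ⟨N, hN, u, j, hj, h.symm⟩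
  exact (Relation.ReflTransGen.stdSymm.symm _ _ (key i hi)).trans (key j hj)

theorem PowersOf.not_matchesAt_of_not_inLat (hC3 : traceOf C3 = CTrace) (hH : SatH C3 2 4)
    (hP : PowersOf C3 2 P) (s : ℕ) {x : Pt 3} (hx : latt x) (hx4 : ¬ inLat 4 x) :
    ¬ MatchesAt (traceOf (P (s + 1))) x := by
  intro hm
  obtain ⟨z, rfl⟩ := exists_emb_of_latt hx
  obtain ⟨M, hM, i, hi, hres, j, hj, hji, N, hN, k, hk, h1, h2, h3⟩ :=
    exists_conflicting (z.1 % 4).toNat (by simp; omega) (z.2.1 % 4).toNat (by simp; omega)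
      (z.2.2 % 4).toNat (by simp; omega) (by
        intro h
        simp only [Prod.mk.injEq] at h
        refine hx4 ?_
        have : emb z = ((4 : ℕ) : ℝ) • emb (z.1 / 4, z.2.1 / 4, z.2.2 / 4) := by
          rw [smul_emb]
          congr 1
          ext <;> simp <;> omega
        rw [this]
        exact inLat_smul_emb 4 _)
  obtain ⟨u, rfl⟩ : ∃ u, z = M.getD i 0 + 4 • u := by
    simp only [residue, Prod.mk.injEq, Int.ofNat_eq_natCast] at hres
    refine ⟨((z.1 - (M.getD i 0).1) / 4, (z.2.1 - (M.getD i 0).2.1) / 4,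
      (z.2.2 - (M.getD i 0).2.2) / 4), ?_⟩
    ext <;> simp only [Prod.fst_add, Prod.snd_add, Prod.smul_fst, Prod.smul_snd] <;>
      simp only [nsmul_eq_mul, Nat.cast_ofNat] <;> omega
  simp only [List.mem_range] at hi hj hk
  have lift : ∀ {S T}, CTrace.conn S T → (traceOf (P (s + 1))).conn S T :=
    fun h => hP.conn_of_CTrace hC3 hH s h
  have hMt := turn_ne M hM j hj
  have hN' : N ∈ intBlocks := List.mem_append_left _ hN
  have hNt := turn_ne N hN' k hk
  have hi' : ∃ i' < 8, emb (M.getD i 0 + 4 • u) ∈ blockSeg M u i' := by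
    rcases Nat.lt_or_ge i 8 with h | h
    · exact ⟨i, h, Sym2.mem_mk_left _ _⟩
    · obtain rfl : i = 7 + 1 := by omega
      exact ⟨7, by omega, Sym2.mem_mk_right _ _⟩
  obtain ⟨i', hi8, hi'⟩ := hi'
  have hS : blockSeg M u i' ∈ (traceOf (P (s + 1))).segs :=
    hP.mem_segs hH (s + 1) (isSeg_of_mem (hC3 ▸ CTrace_segs.2 ⟨M, hM, u, i', hi8, rfl⟩))
  have e1 := hm _ hS hi' (emb (M.getD j 0 + 4 • u)) (emb (M.getD (j + 1) 0 + 4 • u))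
    (emb (M.getD (j + 2) 0 + 4 • u)) (by simpa [emb_injective.eq_iff] using hMt)
    (by simpa [emb_injective.eq_iff] using hji)
    (Relation.ReflTransGen.mono (fun _ _ h => lift h) _ _ (blockSeg_chain hM u hi8 (by omega)))
    (lift (CTrace_conn_turn hM u hj))
  simp only [← emb_sub, add_sub_add_right_eq_sub] at e1
  have e2 := lift (CTrace_conn_turn hN' 0 hk)
  simp only [blockSeg, smul_zero, add_zero, h1, h2] at e2
  refine h3 (emb_injective (traceOf_conn_unique (hP.1 (s + 1)) ?_ ?_ e1 e2)).symm
  · simpa [emb_injective.eq_iff] using hMt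
  · rw [← h1]
    exact emb_injective.ne hNt

/-- Deconvolution by `𝒞` at the points of `4ℤ³`. -/
theorem PowersOf.matchesAt_half (hC3 : traceOf C3 = CTrace) (hH : SatH C3 2 4)
    (hP : PowersOf C3 2 P) (s : ℕ) (w : ℤ × ℤ × ℤ)
    (hm : MatchesAt (traceOf (P (s + 1))) (emb (4 • w))) :
    MatchesAt (traceOf (P s)) (emb (2 • w)) := by
  intro S hS hxS p q r hpr hqx hchain hconn
  have e := two_smul_emb_two_smul w
  obtain ⟨A, B, hA, hB, hqA, hqB, hAB⟩ := hP.exists_conn_lift hH s hconn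
  obtain ⟨hseg1, hseg2⟩ := isSeg_of_conn hconn
  obtain ⟨a, rfl⟩ := Sym2.mem_iff_exists.1 hqA
  obtain ⟨b, rfl⟩ := Sym2.mem_iff_exists.1 hqB
  have hab : a ≠ b := by
    rintro rfl
    have := Over.unique' hC3 hseg1 hseg2 hA hB
    rw [Sym2.eq_swap, Sym2.congr_left] at this
    exact hpr this.symm
  rw [Sym2.eq_swap (a := _ • q) (b := a)] at hA hAB
  obtain ⟨x', rfl⟩ := Sym2.mem_iff_exists.1 hxS
  have hSseg := isSeg_of_mem hS
  obtain ⟨c, hc, cx, cx'⟩ := exists_curve_of_isSeg hH hSseg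
  obtain ⟨S', hS'⟩ := Curve.exists_endSegAt cx
  have hS'c := Curve.mem_segs_of_endSegAt hS'
  have hover : Over C3 _ S' := ⟨_, _, rfl, c, hc, cx, cx', hS'c⟩
  have hx := Curve.mem_of_endSegAt hS'
  rw [e] at hx
  have key := hm S' (hP.mem_segs hH (s + 1) (Curve.isSeg_of_mem_segs hS'c)) hx a _ b hab
    (by
      rw [← e]
      exact fun h => hqx (two_smul_injective h))
    (hP.chain_lift hH s hSseg hchain hover hA) hAB
  have back : ∀ t y y' : Pt 3, s(y, y') = Sym2.map (fun p => p + t) s(y - t, y' - t) := by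
    intro t y y'
    simp
  rcases hP.conn_cases s key with ⟨R, hR, h1, h2, h⟩ | ⟨R, R', hRR, h1, h2⟩
  · obtain ⟨zq, hzq⟩ := exists_emb_of_latt hseg1.latt_right
    rw [hzq, smul_emb, ← emb_sub, show 2 • zq - 4 • w = 2 • (zq - 2 • w) by
      rw [smul_sub, smul_smul]; rfl, hC3] at h
    exact absurd h (not_CTrace_conn_of_even _ fun h => hab (sub_left_injective h))
  · obtain ⟨hR, hR'⟩ := isSeg_of_conn hRR
    rw [back (emb (4 • w)) a] at hA
    rw [back (emb (4 • w)) _ b] at hB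
    have u1 := Over.unique hC3 w hR hseg1 h1 hA
    have u2 := Over.unique hC3 w hR' hseg2 h2 hB
    rw [back (emb (2 • w)) p q] at u1
    rw [back (emb (2 • w)) q r] at u2
    have inj := Sym2.map.injective (add_left_injective (emb (2 • w)))
    rw [inj u1, inj u2]
    exact hRR

theorem PowersOf.not_matchesAt (hC3 : traceOf C3 = CTrace) (hH : SatH C3 2 4)
    (hP : PowersOf C3 2 P) (s : ℕ) : ∀ {x : Pt 3}, latt x → ¬ inLat (2 ^ (s + 2)) x →
      ¬ MatchesAt (traceOf (P (s + 1))) x := by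
  induction s with
  | zero => exact fun hx h => hP.not_matchesAt_of_not_inLat hC3 hH 0 hx h
  | succ s ih =>
    intro x hx h hm
    by_cases h4 : inLat 4 x
    · obtain ⟨w, rfl⟩ := exists_emb_of_inLat h4
      refine ih (latt_emb (2 • w)) (fun h' => h ?_)
        (hP.matchesAt_half hC3 hH (s + 1) w (by rwa [← smul_emb]))
      have := inLat_smul (m := 2) h'
      rwa [smul_emb, smul_smul, ← pow_succ', show 2 * 2 = 4 from rfl, ← smul_emb] at this
    · exact hP.not_matchesAt_of_not_inLat hC3 hH (s + 1) hx h4 hm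

end Powers

/-- Lemma 2.6: for each `s ∈ ℕ*`, there exists no
`x ∈ ℤ³ ∖ 2^{s+1}ℤ³` such that `Σ_{s,x}(𝒞^s) ≺ x + Σ_{s,0}(𝒞^s)`. -/
theorem statement13 (C3 : Set (Curve 3)) (hC3 : traceOf C3 = CTrace)
    (hH : SatH C3 2 4) (P : ℕ → Set (Curve 3)) (hP : PowersOf C3 2 P) :
    ∀ s : ℕ, 1 ≤ s → ¬ ∃ x : Pt 3, latt x ∧ ¬ inLat (2 ^ (s + 1)) x ∧
      TPrec (traceOf (SigmaSet s x (P s)))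
        (Trace.transl x (traceOf (SigmaSet s 0 (P s)))) := by
  rintro s hs ⟨x, hx, hxs, h⟩
  obtain ⟨s, rfl⟩ := Nat.exists_eq_add_of_le' hs
  exact hP.not_matchesAt hC3 hH s hx hxs (hP.matchesAt_of_tprec hC3 hH h)

end
end Folding
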